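/- Let M be a graded D-module over R = k[x_1,…,x_n] such that H^n_dR(M) = M/(∂_1^M(M)+⋯+∂_n^M(M)) is a finite-dimensional k-vector space. Then H^0_dR(DD(M)) = ⋂_{i=1}^n ker(∂_i : DD(M) → DD(M)) is a finite-dimensional k-vector space of the same dimension: dim_k H^0_dR(DD(M)) = dim_k H^n_dR(M). -/

import Mathlib

/-!
Statement 2: for a graded `D`-module `M` over `R = k[x₁,…,xₙ]` with
`H^n_dR(M) = M/(∂₁M + ⋯ + ∂ₙM)` finite dimensional,
`H^0_dR(DD(M)) = ⋂ ker ∂_i` has the same (finite) dimension.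
-/

open MvPolynomial
open scoped DirectSum

set_option maxHeartbeats 2000000
set_option synthInstance.maxHeartbeats 1000000

section MatlisDual

variable {k : Type} [Field k] {n : ℕ} {M : Type} [AddCommGroup M] [Module k M]

/-- The carrier of the graded Matlis dual `DD(M)`, with `DD(M)_l = Hom_k(M_{-l-n}, k)`. -/
abbrev DDcar (deg : ℤ → Submodule k M) (n : ℕ) : Type :=
  @DirectSum ℤ (fun l => Module.Dual k ↥(deg (-l - (n : ℤ))))
    (fun l => (inferInstance :
      AddCommGroup (Module.Dual k ↥(deg (-l - (n : ℤ))))).toAddCommMonoid)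

/-- Projection of `M` onto its degree-`l` component. -/
noncomputable def gproj (deg : ℤ → Submodule k M) (hint : DirectSum.IsInternal deg) (l : ℤ) :
    M →ₗ[k] ↥(deg l) :=
  (DirectSum.component k ℤ (fun j => ↥(deg j)) l).comp
    (LinearEquiv.ofBijective (DirectSum.coeLinearMap deg) hint).symm.toLinearMap

/-- The evaluation pairing between `DD(M)` and `M` (injective in the first variable,
hence characterizing the `D`-module structure of `DD(M)` uniquely). -/
noncomputable def gev (deg : ℤ → Submodule k M) (hint : DirectSum.IsInternal deg) :
    DDcar deg n →ₗ[k] Module.Dual k M :=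
  DirectSum.toModule k ℤ (Module.Dual k M)
    (fun l => (gproj deg hint (-l - (n : ℤ))).dualMap)

end MatlisDual

section Pairing

variable {k : Type} [Field k] {n : ℕ} {M : Type} [AddCommGroup M] [Module k M]
  (deg : ℤ → Submodule k M) (hint : DirectSum.IsInternal deg)

lemma gproj_eq_component_lof {j : ℤ} (l : ℤ) {m : M} (hm : m ∈ deg j) :
    gproj deg hint l m = DirectSum.component k ℤ (fun j => ↥(deg j)) l
      (DirectSum.lof k ℤ (fun j => ↥(deg j)) j ⟨m, hm⟩) :=
  congrArg (DirectSum.component k ℤ (fun j => ↥(deg j)) l)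
    ((LinearEquiv.symm_apply_eq _).mpr (DirectSum.coeLinearMap_lof deg j ⟨m, hm⟩).symm)

lemma gproj_of_mem {l : ℤ} {m : M} (hm : m ∈ deg l) : gproj deg hint l m = ⟨m, hm⟩ := by
  rw [gproj_eq_component_lof deg hint l hm, DirectSum.component.lof_self]

lemma gproj_of_mem_of_ne {j l : ℤ} (hjl : j ≠ l) {m : M} (hm : m ∈ deg j) :
    gproj deg hint l m = 0 := by
  rw [gproj_eq_component_lof deg hint l hm, DirectSum.component.of, dif_neg hjl]

lemma linearMap_ext_of_isInternal {V : Type*} [AddCommGroup V] [Module k V] {f g : M →ₗ[k] V}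
    (hint : DirectSum.IsInternal deg) (h : ∀ l, ∀ m ∈ deg l, f m = g m) : f = g := by
  have htop : ⨆ l, deg l ≤ LinearMap.eqLocus f g := iSup_le fun l m hm => h l m hm
  rw [hint.submodule_iSup_eq_top] at htop
  exact LinearMap.ext fun m => htop (Submodule.mem_top (x := m))

lemma gev_lof (j : ℤ) (a : Module.Dual k ↥(deg (-j - (n : ℤ)))) (m : M) :
    gev deg hint (DirectSum.lof k ℤ (fun l => Module.Dual k ↥(deg (-l - (n : ℤ)))) j a) m =
      a (gproj deg hint (-j - (n : ℤ)) m) := by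
  unfold gev
  erw [DirectSum.toModule_lof]
  rfl

lemma gev_of_mem (lam : DDcar deg n) (j : ℤ) {m : M} (hm : m ∈ deg (-j - (n : ℤ))) :
    gev deg hint lam m =
      DirectSum.component k ℤ (fun l => Module.Dual k ↥(deg (-l - (n : ℤ)))) j lam ⟨m, hm⟩ := by
  induction lam using DirectSum.induction_on with
  | zero => simp
  | of i a =>
    refine (gev_lof deg hint i a m).trans ?_
    change _ = DirectSum.component k ℤ (fun l => Module.Dual k ↥(deg (-l - (n : ℤ)))) j
      (DirectSum.lof k ℤ (fun l => Module.Dual k ↥(deg (-l - (n : ℤ)))) i a) ⟨m, hm⟩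
    by_cases hij : i = j
    · subst hij
      rw [gproj_of_mem deg hint hm, DirectSum.component.lof_self]
    · rw [gproj_of_mem_of_ne deg hint (by omega) hm, DirectSum.component.of, dif_neg hij]
      simp
  | add x y hx hy => simp only [map_add, LinearMap.add_apply, hx, hy]

lemma gev_injective : Function.Injective (gev deg hint (n := n)) := by
  rw [injective_iff_map_eq_zero]
  intro lam h
  refine DirectSum.ext_component k fun j => ?_
  ext ⟨m, hm⟩
  rw [← gev_of_mem deg hint lam j hm, h]
  simp

/-- A functional vanishing on all but finitely many graded pieces lies in the graded dual. -/
lemma exists_gev_eq (φ : Module.Dual k M) (S : Finset ℤ)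
    (hφ : ∀ l ∉ S, ∀ m ∈ deg l, φ m = 0) : ∃ lam : DDcar deg n, gev deg hint lam = φ := by
  refine ⟨∑ l ∈ S, DirectSum.lof k ℤ (fun l => Module.Dual k ↥(deg (-l - (n : ℤ))))
    (-l - n) (φ.comp (deg (-(-l - (n : ℤ)) - n)).subtype), ?_⟩
  refine linearMap_ext_of_isInternal deg hint fun l m hm => ?_
  rw [map_sum, LinearMap.sum_apply]
  have hterm : ∀ j ∈ S, j ≠ l → gev deg hint (DirectSum.lof k ℤ
      (fun l => Module.Dual k ↥(deg (-l - (n : ℤ)))) (-j - n)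
        (φ.comp (deg (-(-j - (n : ℤ)) - n)).subtype)) m = 0 := by
    intro j _ hj
    rw [gev_lof, gproj_of_mem_of_ne deg hint (by omega) hm, map_zero]
  by_cases hl : l ∈ S
  · rw [Finset.sum_eq_single_of_mem l hl hterm, gev_lof,
      gproj_of_mem deg hint (show m ∈ deg (-(-l - (n : ℤ)) - n) by simpa using hm)]
    rfl
  · rw [hφ l hl m hm]
    exact Finset.sum_eq_zero fun j hj => hterm j hj fun h => hl (h ▸ hj)

lemma gproj_mem_iSup_range {ι : Type*} (pd : ι → Module.End k M)
    (hpd : ∀ (i : ι) (l : ℤ), ∀ m ∈ deg l, pd i m ∈ deg (l - 1)) (l : ℤ) {m : M}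
    (hm : m ∈ ⨆ i, LinearMap.range (pd i)) :
    (gproj deg hint l m : M) ∈ ⨆ i, LinearMap.range (pd i) := by
  suffices h : ⨆ i, LinearMap.range (pd i) ≤
      (⨆ i, LinearMap.range (pd i)).comap ((deg l).subtype ∘ₗ gproj deg hint l) from h hm
  refine iSup_le fun i => ?_
  rintro _ ⟨x, rfl⟩
  have hcomp : ((deg l).subtype ∘ₗ gproj deg hint l) ∘ₗ pd i =
      pd i ∘ₗ (deg (l + 1)).subtype ∘ₗ gproj deg hint (l + 1) := by
    refine linearMap_ext_of_isInternal deg hint fun j x hx => ?_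
    simp only [LinearMap.comp_apply, Submodule.subtype_apply]
    by_cases hj : j = l + 1
    · subst hj
      rw [gproj_of_mem deg hint hx,
        gproj_of_mem deg hint (show pd i x ∈ deg l by simpa using hpd i _ x hx)]
    · rw [gproj_of_mem_of_ne deg hint hj hx,
        gproj_of_mem_of_ne deg hint (by omega) (hpd i j x hx)]
      simp
  exact Submodule.mem_iSup_of_mem i ⟨_, (LinearMap.congr_fun hcomp x).symm⟩

/-- A homogeneous subspace of finite codimension contains almost all graded pieces. -/
lemma exists_finset_deg_le (N : Submodule k M) [FiniteDimensional k (M ⧸ N)]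
    (hN : ∀ l, ∀ m ∈ N, (gproj deg hint l m : M) ∈ N) :
    ∃ S : Finset ℤ, ∀ l ∉ S, deg l ≤ N := by
  have hfg : IsCompactElement (⊤ : Submodule k (M ⧸ N)) :=
    (Submodule.fg_iff_compact _).mp Module.Finite.fg_top
  have htop : (⊤ : Submodule k (M ⧸ N)) ≤ ⨆ l, (deg l).map N.mkQ := by
    rw [← Submodule.map_iSup, hint.submodule_iSup_eq_top, Submodule.map_top, N.range_mkQ]
  obtain ⟨S, hS⟩ := CompleteLattice.IsCompactElement.exists_finset_of_le_iSup _ hfg _ htop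
  refine ⟨S, fun l hl m hm => ?_⟩
  have hmS : N.mkQ m ∈ (⨆ j ∈ S, deg j).map N.mkQ := by
    simp only [Submodule.map_iSup]
    exact hS Submodule.mem_top
  obtain ⟨w, hw, hwm⟩ := hmS
  have hker : ⨆ j ∈ S, deg j ≤ LinearMap.ker (gproj deg hint l) :=
    iSup₂_le fun j hj x hx => gproj_of_mem_of_ne deg hint (ne_of_mem_of_not_mem hj hl) hx
  have h := hN l (w - m) ((Submodule.Quotient.eq N).mp hwm)
  rw [map_sub, LinearMap.mem_ker.mp (hker hw), gproj_of_mem deg hint hm] at h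
  simpa using h

end Pairing

/-- Let `M` be a graded `D`-module over `R = k[x₁,…,xₙ]` (`char k = 0`,
`n ≥ 1`) such that `H^n_dR(M) = M/(∂₁(M)+⋯+∂ₙ(M))` is finite dimensional over `k`.
Let `Dpd` be the `∂`-operators of the graded Matlis dual `DD(M)` (characterized by
`⟨∂_i·λ, m⟩ = -⟨λ, ∂_i m⟩`).  Then `H^0_dR(DD(M)) = ⋂_i ker (Dpd i)` is finite
dimensional of the same dimension. -/
theorem H0_of_graded_Matlis_dual_dual_to_Hn
    {k : Type} [Field k] [CharZero k] {n : ℕ} (hn : 0 < n)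
    {M : Type} [AddCommGroup M] [Module k M]
    [Module (MvPolynomial (Fin n) k) M] [IsScalarTower k (MvPolynomial (Fin n) k) M]
    (pd : Fin n → Module.End k M)
    (hcomm : ∀ i j, Commute (pd i) (pd j))
    (hleib : ∀ (i : Fin n) (f : MvPolynomial (Fin n) k) (m : M),
      pd i (f • m) = (pderiv i f) • m + f • (pd i m))
    (deg : ℤ → Submodule k M)
    (hint : DirectSum.IsInternal deg)
    (hsmul : ∀ (d : ℕ) (f : MvPolynomial (Fin n) k), f.IsHomogeneous d →
      ∀ (l : ℤ), ∀ m ∈ deg l, f • m ∈ deg (l + d))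
    (hpd : ∀ (i : Fin n) (l : ℤ), ∀ m ∈ deg l, pd i m ∈ deg (l - 1))
    (Dpd : Fin n → Module.End k (DDcar deg n))
    (hDpd : ∀ (i : Fin n) (lam : DDcar deg n) (m : M),
      gev deg hint (Dpd i lam) m = - gev deg hint lam (pd i m))
    (hfin : FiniteDimensional k (M ⧸ (⨆ i : Fin n, LinearMap.range (pd i)))) :
    FiniteDimensional k ↥(⨅ i : Fin n, LinearMap.ker (Dpd i)) ∧
      Module.finrank k ↥(⨅ i : Fin n, LinearMap.ker (Dpd i)) =
        Module.finrank k (M ⧸ (⨆ i : Fin n, LinearMap.range (pd i))) := by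
  set N := ⨆ i : Fin n, LinearMap.range (pd i)
  obtain ⟨S, hS⟩ := exists_finset_deg_le deg hint N
    fun l m hm => gproj_mem_iSup_range deg hint pd hpd l hm
  have hmem : ∀ lam : DDcar deg n,
      lam ∈ ⨅ i : Fin n, LinearMap.ker (Dpd i) ↔ gev deg hint lam ∈ N.dualAnnihilator := by
    intro lam
    have hker : ∀ i, Dpd i lam = 0 ↔ ∀ m, gev deg hint lam (pd i m) = 0 := fun i => by
      rw [← (gev_injective deg hint).eq_iff, map_zero, LinearMap.ext_iff]
      simp [hDpd]
    simp only [Submodule.mem_iInf, LinearMap.mem_ker, hker]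
    simp only [N, Submodule.dualAnnihilator_iSup_eq, Submodule.mem_iInf,
      Submodule.mem_dualAnnihilator, LinearMap.mem_range, forall_exists_index,
      forall_apply_eq_imp_iff]
  let F := (gev deg hint).restrict fun lam h => (hmem lam).mp h
  have hF : Function.Bijective F := by
    refine ⟨fun x y h => Subtype.ext (gev_injective deg hint (congrArg Subtype.val h)), ?_⟩
    rintro ⟨φ, hφ⟩
    obtain ⟨lam, rfl⟩ := exists_gev_eq (n := n) deg hint φ S fun l hl m hm =>
      (Submodule.mem_dualAnnihilator φ).mp hφ m (hS l hl hm)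
    exact ⟨⟨lam, (hmem lam).mpr hφ⟩, rfl⟩
  let e := (LinearEquiv.ofBijective F hF).trans N.dualQuotEquivDualAnnihilator.symm
  exact ⟨Module.Finite.equiv e.symm, e.finrank_eq.trans Subspace.dual_finrank_eq⟩
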